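/- arXiv:1212.1023 — 2 statements merged into one kernel-verified Lean document; each statement's English description precedes it below -/
import Mathlib

section
/- Each polynomial J_{k,i}, 1 ≤ k ≤ n, 0 ≤ i ≤ k−1, is a U-invariant of the adjoint representation: for every upper unitriangular u ∈ U and every A ∈ M one has J_{k,i}(u⁻¹Au) = J_{k,i}(A). -/
open Matrix

/-- `u` is an upper triangular matrix with all diagonal entries equal to `1`
(upper unitriangular matrix). -/
def IsUniUpperTriangular {n : ℕ} {K : Type*} [CommRing K]
    (u : Matrix (Fin n) (Fin n) K) : Prop :=
  (∀ a : Fin n, u a a = 1) ∧ ∀ a b : Fin n, (b : ℕ) < (a : ℕ) → u a b = 0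

/-- The polynomial invariant `J_{k,i}` evaluated at a matrix `A`:
the determinant of the `k × k` matrix whose first `k - i` rows are the last
`k - i` rows of `A` (rows `n-(k-i)+1, …, n` in 1-indexing) restricted to the
first `k` columns, and whose last `i` rows are the last `i` rows of the
adjugate matrix `A*` restricted to the first `k` columns. -/
def Jki {n : ℕ} {K : Type*} [CommRing K] (k i : ℕ) (hk : k ≤ n) (hik : i < k)
    (A : Matrix (Fin n) (Fin n) K) : K :=
  Matrix.det (Matrix.of fun r c : Fin k =>
    if h : (r : ℕ) < k - i then
      A ⟨n - (k - i) + (r : ℕ), by have := r.isLt; omega⟩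
        ⟨(c : ℕ), by have := c.isLt; omega⟩
    else
      A.adjugate ⟨n - i + ((r : ℕ) - (k - i)), by have := r.isLt; omega⟩
        ⟨(c : ℕ), by have := c.isLt; omega⟩)

/-- The row of the big matrix used as row `r` of the matrix defining `J_{k,i}`. -/
def rowIx {n : ℕ} (k i : ℕ) (hk : k ≤ n) (hik : i < k) (r : Fin k) : Fin n :=
  if h : (r : ℕ) < k - i then ⟨n - (k - i) + (r : ℕ), by have := r.isLt; omega⟩
  else ⟨n - i + ((r : ℕ) - (k - i)), by have := r.isLt; omega⟩

theorem rowIx_lt {n k i : ℕ} (hk : k ≤ n) (hik : i < k) (r : Fin k) (h : (r : ℕ) < k - i) :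
    (rowIx k i hk hik r : ℕ) = n - (k - i) + r := by
  simp [rowIx, h]

theorem rowIx_ge {n k i : ℕ} (hk : k ≤ n) (hik : i < k) (r : Fin k) (h : ¬ (r : ℕ) < k - i) :
    (rowIx k i hk hik r : ℕ) = n - i + (r - (k - i)) := by
  simp [rowIx, h]

theorem det_uni {n : ℕ} {K : Type*} [CommRing K] (u : Matrix (Fin n) (Fin n) K)
    (hu : IsUniUpperTriangular u) : u.det = 1 := by
  rw [Matrix.det_of_isUpperTriangular (fun a b h => hu.2 a b h)]
  simp [hu.1]

theorem sum_lt {n k i : ℕ} {K : Type*} [CommRing K] (hk : k ≤ n) (hik : i < k)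
    (f : Fin n → K) (hf : ∀ j : Fin n, (j : ℕ) < n - (k - i) → f j = 0) :
    ∑ s : Fin k, (if (s : ℕ) < k - i then f (rowIx k i hk hik s) else 0) = ∑ j, f j := by
  rw [← Finset.sum_filter]
  refine Finset.sum_of_injOn (rowIx k i hk hik) ?_ ?_ ?_ ?_
  · intro a ha b hb hab
    have ha : (a : ℕ) < k - i := by simpa using ha
    have hb : (b : ℕ) < k - i := by simpa using hb
    have h := congrArg Fin.val hab
    rw [rowIx_lt hk hik a ha, rowIx_lt hk hik b hb] at h
    exact Fin.ext (by omega)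
  · intro a _; simp
  · intro j _ hj
    apply hf
    by_contra hc
    apply hj
    have hjn := j.isLt
    have hlt : (j : ℕ) - (n - (k - i)) < k - i := by omega
    refine ⟨⟨(j : ℕ) - (n - (k - i)), by omega⟩, by simpa using hlt, Fin.ext ?_⟩
    rw [rowIx_lt hk hik _ hlt]
    simp only []
    omega
  · intro a _; rfl

theorem sum_ge {n k i : ℕ} {K : Type*} [CommRing K] (hk : k ≤ n) (hik : i < k)
    (f : Fin n → K) (hf : ∀ j : Fin n, (j : ℕ) < n - i → f j = 0) :
    ∑ s : Fin k, (if ¬ (s : ℕ) < k - i then f (rowIx k i hk hik s) else 0) = ∑ j, f j := by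
  rw [← Finset.sum_filter]
  refine Finset.sum_of_injOn (rowIx k i hk hik) ?_ ?_ ?_ ?_
  · intro a ha b hb hab
    have ha : ¬ (a : ℕ) < k - i := by simpa using ha
    have hb : ¬ (b : ℕ) < k - i := by simpa using hb
    have h := congrArg Fin.val hab
    rw [rowIx_ge hk hik a ha, rowIx_ge hk hik b hb] at h
    exact Fin.ext (by omega)
  · intro a _; simp
  · intro j _ hj
    apply hf
    by_contra hc
    apply hj
    have hjn := j.isLt
    have hlt : ¬ (j : ℕ) - (n - i) + (k - i) < k - i := by omega
    refine ⟨⟨(j : ℕ) - (n - i) + (k - i), by omega⟩, by simp; omega, Fin.ext ?_⟩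
    rw [rowIx_ge hk hik _ hlt]
    simp only []
    omega
  · intro a _; rfl

theorem sum_col {n k : ℕ} {K : Type*} [CommRing K] (hk : k ≤ n)
    (f : Fin n → K) (hf : ∀ j : Fin n, k ≤ (j : ℕ) → f j = 0) :
    ∑ s : Fin k, f (Fin.castLE hk s) = ∑ j, f j := by
  refine Finset.sum_of_injOn (Fin.castLE hk) ?_ ?_ ?_ ?_
  · exact (Fin.castLE_injective hk).injOn
  · intro a _; simp
  · intro j _ hj
    apply hf
    by_contra hc
    exact hj ⟨⟨j, by omega⟩, by simp, rfl⟩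
  · intro a _; rfl

/-- The matrix defining `J_{k,i}`. -/
def JMat {n : ℕ} {K : Type*} [CommRing K] (k i : ℕ) (hk : k ≤ n) (hik : i < k)
    (A A' : Matrix (Fin n) (Fin n) K) : Matrix (Fin k) (Fin k) K :=
  Matrix.of fun r c => if (r : ℕ) < k - i then A (rowIx k i hk hik r) (Fin.castLE hk c)
    else A' (rowIx k i hk hik r) (Fin.castLE hk c)

theorem Jki_eq {n : ℕ} {K : Type*} [CommRing K] (k i : ℕ) (hk : k ≤ n) (hik : i < k)
    (A : Matrix (Fin n) (Fin n) K) :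
    Jki k i hk hik A = (JMat k i hk hik A A.adjugate).det := by
  unfold Jki JMat
  congr 1
  ext r c
  by_cases h : (r : ℕ) < k - i <;> simp [h, rowIx, Fin.castLE]

/-- The left multiplier. -/
def LMat {n : ℕ} {K : Type*} [CommRing K] (k i : ℕ) (hk : k ≤ n) (hik : i < k)
    (u : Matrix (Fin n) (Fin n) K) : Matrix (Fin k) (Fin k) K :=
  Matrix.of fun r s => if ((r : ℕ) < k - i ↔ (s : ℕ) < k - i) then
    u (rowIx k i hk hik r) (rowIx k i hk hik s) else 0

theorem LMat_uni {n : ℕ} {K : Type*} [CommRing K] (k i : ℕ) (hk : k ≤ n) (hik : i < k)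
    (u : Matrix (Fin n) (Fin n) K) (hu : IsUniUpperTriangular u) :
    IsUniUpperTriangular (LMat k i hk hik u) := by
  refine ⟨fun a => by simp [LMat, hu.1], fun a b hab => ?_⟩
  simp only [LMat, Matrix.of_apply]
  split_ifs with h
  · apply hu.2
    by_cases ha : (a : ℕ) < k - i
    · rw [rowIx_lt hk hik a ha, rowIx_lt hk hik b (h.1 ha)]; omega
    · have hb : ¬ (b : ℕ) < k - i := fun hb => ha (h.2 hb)
      rw [rowIx_ge hk hik a ha, rowIx_ge hk hik b hb]; omega
  · rfl

theorem LMat_mul {n : ℕ} {K : Type*} [CommRing K] (k i : ℕ) (hk : k ≤ n) (hik : i < k)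
    (u B B' : Matrix (Fin n) (Fin n) K) (hu : IsUniUpperTriangular u) :
    LMat k i hk hik u * JMat k i hk hik B B' = JMat k i hk hik (u * B) (u * B') := by
  ext r c
  rw [Matrix.mul_apply]
  by_cases hr : (r : ℕ) < k - i
  · simp only [LMat, JMat, Matrix.of_apply, hr, true_iff, if_true, Matrix.mul_apply]
    rw [← sum_lt hk hik]
    · refine Finset.sum_congr rfl fun s _ => ?_
      split_ifs <;> simp
    · intro j hj
      rw [hu.2 _ _ (by rw [rowIx_lt hk hik r hr]; omega), zero_mul]
  · simp only [LMat, JMat, Matrix.of_apply, hr, false_iff, if_false, Matrix.mul_apply]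
    rw [← sum_ge hk hik]
    · refine Finset.sum_congr rfl fun s _ => ?_
      by_cases hs : (s : ℕ) < k - i <;> simp [hs]
    · intro j hj
      rw [hu.2 _ _ (by rw [rowIx_ge hk hik r hr]; omega), zero_mul]

theorem JMat_mul {n : ℕ} {K : Type*} [CommRing K] (k i : ℕ) (hk : k ≤ n) (hik : i < k)
    (u B B' : Matrix (Fin n) (Fin n) K) (hu : IsUniUpperTriangular u) :
    JMat k i hk hik B B' * u.submatrix (Fin.castLE hk) (Fin.castLE hk)
      = JMat k i hk hik (B * u) (B' * u) := by
  ext r c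
  rw [Matrix.mul_apply]
  have hz : ∀ j : Fin n, k ≤ (j : ℕ) → u j (Fin.castLE hk c) = 0 := fun j hj =>
    hu.2 _ _ (by have := c.isLt; simp only [Fin.val_castLE]; omega)
  by_cases hr : (r : ℕ) < k - i
  · simp only [JMat, Matrix.of_apply, hr, if_true, Matrix.mul_apply, Matrix.submatrix_apply]
    exact sum_col hk (fun j => B (rowIx k i hk hik r) j * u j (Fin.castLE hk c))
      fun j hj => by simp only [hz j hj, mul_zero]
  · simp only [JMat, Matrix.of_apply, hr, if_false, Matrix.mul_apply, Matrix.submatrix_apply]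
    exact sum_col hk (fun j => B' (rowIx k i hk hik r) j * u j (Fin.castLE hk c))
      fun j hj => by simp only [hz j hj, mul_zero]

/-- Each `J_{k,i}`, `1 ≤ k ≤ n`, `0 ≤ i ≤ k-1`, is a `U`-invariant of the
adjoint representation: `J_{k,i}(u⁻¹ A u) = J_{k,i}(A)` for every upper
unitriangular `u` and every matrix `A`. -/
theorem Jki_adjoint_invariant {n : ℕ} {K : Type*} [Field K] [CharZero K]
    (hn : 1 ≤ n) (u : Matrix (Fin n) (Fin n) K) (hu : IsUniUpperTriangular u)
    (A : Matrix (Fin n) (Fin n) K)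
    (k i : ℕ) (hk1 : 1 ≤ k) (hk : k ≤ n) (hik : i ≤ k - 1) :
    Jki k i hk (by omega) (u⁻¹ * A * u) = Jki k i hk (by omega) A := by
  have hik' : i < k := by omega
  have hd := det_uni u hu
  have hunit : IsUnit u.det := by rw [hd]; exact isUnit_one
  have hinv : u.adjugate = u⁻¹ := by rw [Matrix.inv_def, hd]; simp
  have hinv' : (u⁻¹).adjugate = u := by
    have h1 : (u⁻¹).det = 1 := by rw [Matrix.det_nonsing_inv, hd]; simp
    have h2 : (u⁻¹)⁻¹ = u := Matrix.nonsing_inv_nonsing_inv u hunit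
    rw [Matrix.inv_def, h1] at h2
    simpa using h2
  have hB : u * (u⁻¹ * A * u) = A * u := by
    rw [Matrix.mul_assoc u⁻¹, Matrix.mul_nonsing_inv_cancel_left _ _ hunit]
  have hB' : u * (u⁻¹ * A * u).adjugate = A.adjugate * u := by
    rw [Matrix.adjugate_mul_distrib, Matrix.adjugate_mul_distrib, hinv, hinv',
      Matrix.mul_nonsing_inv_cancel_left _ _ hunit]
  have hL := LMat_mul k i hk hik' u (u⁻¹ * A * u) (u⁻¹ * A * u).adjugate hu
  have hR := JMat_mul k i hk hik' u A A.adjugate hu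
  rw [hB, hB', ← hR] at hL
  have hdet := congrArg Matrix.det hL
  have hRu : IsUniUpperTriangular (u.submatrix (Fin.castLE hk) (Fin.castLE hk)) :=
    ⟨fun a => hu.1 _, fun a b hab => hu.2 _ _ hab⟩
  rw [Matrix.det_mul, Matrix.det_mul, det_uni _ (LMat_uni k i hk hik' u hu), det_uni _ hRu,
    one_mul, mul_one] at hdet
  rw [Jki_eq, Jki_eq]
  exact hdet
end

section
/- For every B ∈ L and all 1 ≤ i ≤ k−1 ≤ n−1, one has J_{k,i}(B) = (−1)^{i(k−i)} · det(S) · det(C), where S is the (k−i)×(k−i) submatrix of B formed by its last k−i rows and columns i+1,…,k, and C is the i×i submatrix of the adjugate B* formed by its last i rows and first i columns. -/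
open Matrix

/-- `B` belongs to `L`: all entries strictly above the anti-diagonal vanish
(`B_{a,c} = 0` whenever `a + c ≤ n` in 1-indexing) and all anti-diagonal
entries `B_{n+1-c,c}` are nonzero. -/
def MemL {n : ℕ} {K : Type*} [CommRing K] (B : Matrix (Fin n) (Fin n) K) : Prop :=
  (∀ a c : Fin n, (a : ℕ) + (c : ℕ) + 2 ≤ n → B a c = 0) ∧
    ∀ c : Fin n, B ⟨n - 1 - (c : ℕ), by have := c.isLt; omega⟩ c ≠ 0

theorem aux_sign (m i : ℕ) (hi : 1 ≤ i) :
    ((-1 : ℤˣ) ^ (m + i - 1)) ^ i = (-1) ^ (i * m) := by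
  obtain ⟨j, rfl⟩ : ∃ j, i = j + 1 := ⟨i - 1, by omega⟩
  rw [← pow_mul]
  have h1 : (m + (j + 1) - 1) * (j + 1) = (j + 1) * m + j * (j + 1) := by
    have : m + (j + 1) - 1 = m + j := by omega
    rw [this]; ring
  rw [h1, pow_add, (Nat.even_mul_succ_self j).neg_one_pow, mul_one]

theorem aux_rotate (N : ℕ) [NeZero N] (j : ℕ) (c : Fin N) :
    ((((finRotate N) ^ j) c : Fin N) : ℕ) = (c + j) % N := by
  obtain ⟨M, rfl⟩ : ∃ M, N = M + 1 := ⟨N - 1, by have := NeZero.pos N; omega⟩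
  induction j with
  | zero => simp [Nat.mod_eq_of_lt c.isLt]
  | succ j ih =>
    rw [pow_succ', Equiv.Perm.mul_apply, finRotate_succ_apply, Fin.val_add, ih]
    rw [Fin.coe_ofNat_eq_mod, Nat.add_mod_mod, Nat.mod_add_mod, add_assoc]

theorem aux_block {K : Type*} [Field K] (k m i : ℕ) (hi : 1 ≤ i) (hk : k = m + i)
    (M : Matrix (Fin k) (Fin k) K)
    (h0 : ∀ r c : Fin k, m ≤ (r : ℕ) → i ≤ (c : ℕ) → M r c = 0) :
    M.det = (-1 : K) ^ (i * m) *
      Matrix.det (Matrix.of fun r c : Fin m =>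
        M ⟨r, by have := r.isLt; omega⟩ ⟨i + c, by have := c.isLt; omega⟩) *
      Matrix.det (Matrix.of fun r c : Fin i =>
        M ⟨m + r, by have := r.isLt; omega⟩ ⟨c, by have := c.isLt; omega⟩) := by
  subst hk
  haveI : NeZero (m + i) := ⟨by omega⟩
  have hp := Matrix.det_permute' ((finRotate (m + i)) ^ i) M
  rw [map_pow, sign_finRotate, aux_sign m i hi] at hp
  have hb : (M.submatrix id ((finRotate (m + i)) ^ i)).submatrix finSumFinEquiv finSumFinEquiv =
      Matrix.fromBlocks
        (Matrix.of fun r c : Fin m =>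
          M ⟨r, by have := r.isLt; omega⟩ ⟨i + c, by have := c.isLt; omega⟩)
        (Matrix.of fun (r : Fin m) (c : Fin i) =>
          M ⟨r, by have := r.isLt; omega⟩ ⟨c, by have := c.isLt; omega⟩)
        0
        (Matrix.of fun r c : Fin i =>
          M ⟨m + r, by have := r.isLt; omega⟩ ⟨c, by have := c.isLt; omega⟩) := by
    have e1 : ∀ c : Fin m, ((finRotate (m + i)) ^ i) (Fin.castAdd i c) =
        ⟨i + c, by have := c.isLt; omega⟩ := by
      intro c
      apply Fin.ext
      rw [aux_rotate]
      simp only [Fin.val_castAdd]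
      rw [Nat.mod_eq_of_lt (by have := c.isLt; omega), add_comm]
    have e2 : ∀ c : Fin i, ((finRotate (m + i)) ^ i) (Fin.natAdd m c) =
        ⟨c, by have := c.isLt; omega⟩ := by
      intro c
      apply Fin.ext
      rw [aux_rotate]
      simp only [Fin.val_natAdd]
      rw [show m + (c : ℕ) + i = c + (m + i) by ring, Nat.add_mod_right,
        Nat.mod_eq_of_lt (by have := c.isLt; omega)]
    ext r c
    rcases r with r | r <;> rcases c with c | c
    · simp only [submatrix_apply, finSumFinEquiv_apply_left, e1, fromBlocks_apply₁₁, of_apply, id]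
      rfl
    · simp only [submatrix_apply, finSumFinEquiv_apply_left, finSumFinEquiv_apply_right, e2,
        fromBlocks_apply₁₂, of_apply, id]
      rfl
    · simp only [submatrix_apply, finSumFinEquiv_apply_left, finSumFinEquiv_apply_right, e1,
        fromBlocks_apply₂₁, id]
      exact h0 _ _ (by simp) (by simp)
    · simp only [submatrix_apply, finSumFinEquiv_apply_right, e2, fromBlocks_apply₂₂, of_apply, id]
      rfl
  have hd := congrArg Matrix.det hb
  rw [Matrix.det_submatrix_equiv_self, Matrix.det_fromBlocks_zero₂₁, hp] at hd
  rw [mul_assoc, ← hd, ← mul_assoc]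
  push_cast
  rw [← mul_pow]
  simp

theorem aux_adj {n : ℕ} {K : Type*} [Field K] (B : Matrix (Fin n) (Fin n) K) (hB : MemL B)
    (a c : Fin n) (hac : n ≤ (a : ℕ) + c) : B.adjugate a c = 0 := by
  obtain ⟨hz, hd⟩ := hB
  set T := B.submatrix (Fin.revPerm : Equiv.Perm (Fin n)) (Equiv.refl (Fin n)) with hT
  have hT1 : T.BlockTriangular id := by
    intro x y hxy
    have hxy' : (y : ℕ) < x := hxy
    apply hz
    simp [Fin.val_rev]
    omega
  have hdet : T.det ≠ 0 := by
    rw [Matrix.det_of_isUpperTriangular hT1, Finset.prod_ne_zero_iff]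
    intro c _
    have := hd c
    convert this using 1
    simp only [hT, submatrix_apply]
    congr 1
    apply Fin.ext
    simp [Fin.val_rev]
    omega
  have hu : IsUnit T.det := isUnit_iff_ne_zero.mpr hdet
  haveI := Matrix.invertibleOfIsUnitDet T hu
  have hinv := Matrix.blockTriangular_inv_of_blockTriangular hT1
  have hTB : T⁻¹ = B⁻¹.submatrix (Equiv.refl (Fin n)) (Fin.revPerm : Equiv.Perm (Fin n)) :=
    Matrix.inv_submatrix_equiv _ _ _
  have h0 : T⁻¹ a (Fin.rev c) = 0 := by
    apply hinv
    show Fin.rev c < a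
    rw [Fin.lt_def, Fin.val_rev]
    omega
  rw [hTB] at h0
  simp only [submatrix_apply, Equiv.refl_apply, Fin.revPerm_apply, Fin.rev_rev] at h0
  have hBdet : B.det ≠ 0 := by
    intro h
    apply hdet
    have := Matrix.det_permute (Fin.revPerm : Equiv.Perm (Fin n)) B
    rw [h, mul_zero] at this
    exact this
  rw [Matrix.inv_def, Matrix.smul_apply, smul_eq_mul, Ring.inverse_eq_inv'] at h0
  exact (mul_eq_zero.mp h0).resolve_left (inv_ne_zero hBdet)

/-- For `B ∈ L` and `1 ≤ i ≤ k-1 ≤ n-1`,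
`J_{k,i}(B) = (-1)^{i(k-i)} · det S · det C`, where `S` is the
`(k-i) × (k-i)` submatrix of `B` formed by its last `k-i` rows and columns
`i+1, …, k`, and `C` is the `i × i` submatrix of the adjugate `B*` formed by
its last `i` rows and first `i` columns. -/
theorem Jki_on_L_eq {n : ℕ} {K : Type*} [Field K] [CharZero K] (hn : 1 ≤ n)
    (B : Matrix (Fin n) (Fin n) K) (hB : MemL B)
    (k i : ℕ) (hi1 : 1 ≤ i) (hik : i ≤ k - 1) (hk : k ≤ n) (hk1 : 1 ≤ k) :
    Jki k i hk (by omega) B =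
      (-1 : K) ^ (i * (k - i)) *
        Matrix.det (Matrix.of fun r c : Fin (k - i) =>
          B ⟨n - (k - i) + (r : ℕ), by have := r.isLt; omega⟩
            ⟨i + (c : ℕ), by have := c.isLt; omega⟩) *
        Matrix.det (Matrix.of fun r c : Fin i =>
          B.adjugate ⟨n - i + (r : ℕ), by have := r.isLt; omega⟩
            ⟨(c : ℕ), by have := c.isLt; omega⟩) := by
  unfold Jki
  rw [aux_block k (k - i) i hi1 (by omega)]
  · congr 1
    · congr 2
      ext r c
      simp
    · congr 1
      ext r c
      simp
  · intro r c hr hc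
    have hr' : ¬ (r : ℕ) < k - i := by omega
    simp only [of_apply, hr', dite_false]
    apply aux_adj B hB
    simp only
    omega
end
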